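/- arXiv:0903.1470 — 3 statements merged into one kernel-verified Lean document; each statement's English description precedes it below -/
import Mathlib

section
/- Let F and B be locally compact Hausdorff spaces and π : F × B → B the projection. Then the map Φ : M → C(B, C(F,F)) defined by Φ(f)(b)(x) = pr_F(f(x, b)) is an isomorphism of topological monoids: Φ is a homeomorphism, Φ sends the identity map of F × B to the unit (the constant map at id_F), and Φ(f ∘ f') = Φ(f) · Φ(f') for all f, f' ∈ M, where · denotes pointwise composition. -/
/-- A continuous map is a (free) homotopy equivalence. -/
def IsHtpyEquiv {X Y : Type*} [TopologicalSpace X] [TopologicalSpace Y] (f : C(X, Y)) : Prop :=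
  ∃ g : C(Y, X),
    (f.comp g).Homotopic (ContinuousMap.id Y) ∧ (g.comp f).Homotopic (ContinuousMap.id X)

/-- The monoid `M` of continuous self-maps of `F × B` over the projection `π : F × B → B`,
topologized as a subspace of `C(F × B, F × B)` with the compact-open topology. -/
abbrev FibMnd (F B : Type*) [TopologicalSpace F] [TopologicalSpace B] : Type _ :=
  { f : C(F × B, F × B) // ∀ x : F × B, (f x).2 = x.2 }

/-- Composition in `M`. -/
def FibMnd.comp {F B : Type*} [TopologicalSpace F] [TopologicalSpace B]
    (f g : FibMnd F B) : FibMnd F B :=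
  ⟨f.val.comp g.val, fun x => (f.prop (g.val x)).trans (g.prop x)⟩

/-- The identity element of `M`. -/
def FibMnd.one (F B : Type*) [TopologicalSpace F] [TopologicalSpace B] : FibMnd F B :=
  ⟨ContinuousMap.id (F × B), fun _ => rfl⟩

/-- The map `Φ : M → C(B, C(F, F))`, `Φ(f)(b)(x) = pr_F (f (x, b))`, as a continuous map. -/
def PhiC {F B : Type*} [TopologicalSpace F] [TopologicalSpace B] (f : FibMnd F B) :
    C(B, C(F, F)) :=
  ContinuousMap.curry (ContinuousMap.fst.comp (f.val.comp ContinuousMap.prodSwap))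

/-- The map of `F × B` over `B` determined by a continuous family of self-maps of `F`. -/
def FibMnd.ofFamily {F B : Type*} [TopologicalSpace F] [TopologicalSpace B]
    [LocallyCompactSpace F] (g : C(B, C(F, F))) : FibMnd F B :=
  ⟨(g.uncurry.comp ContinuousMap.prodSwap).prodMk ContinuousMap.snd, fun _ => rfl⟩

theorem continuous_PhiC {F B : Type*} [TopologicalSpace F] [TopologicalSpace B]
    [LocallyCompactSpace F] [LocallyCompactSpace B] :
    Continuous (PhiC : FibMnd F B → C(B, C(F, F))) :=
  ContinuousMap.continuous_curry.comp <| (ContinuousMap.continuous_postcomp _).comp <|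
    (ContinuousMap.continuous_precomp _).comp continuous_subtype_val

theorem FibMnd.continuous_ofFamily {F B : Type*} [TopologicalSpace F] [TopologicalSpace B]
    [LocallyCompactSpace F] [LocallyCompactSpace B] :
    Continuous (FibMnd.ofFamily : C(B, C(F, F)) → FibMnd F B) := by
  refine Continuous.subtype_mk (ContinuousMap.continuous_of_continuous_uncurry _ ?_) _
  change Continuous fun p : C(B, C(F, F)) × (F × B) => (p.1 p.2.2 p.2.1, p.2.2)
  fun_prop

/-- For locally compact Hausdorff `F` and `B`, the map `Φ(f)(b)(x) = pr_F(f(x,b))` is an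
isomorphism of topological monoids from `M` onto `C(B, C(F,F))` with pointwise composition:
it is a homeomorphism sending the identity to the constant map at `id_F` and carrying
composition in `M` to pointwise composition. -/
theorem fibre_monoid_iso_mapping_monoid (F B : Type*) [TopologicalSpace F] [TopologicalSpace B]
    [LocallyCompactSpace F] [T2Space F] [LocallyCompactSpace B] [T2Space B] :
    ∃ Φ : FibMnd F B ≃ₜ C(B, C(F, F)),
      (∀ (f : FibMnd F B) (b : B) (x : F), Φ f b x = (f.val (x, b)).1) ∧
      Φ (FibMnd.one F B) = ContinuousMap.const B (ContinuousMap.id F) ∧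
      ∀ f g : FibMnd F B, ∀ b : B, Φ (FibMnd.comp f g) b = (Φ f b).comp (Φ g b) := by
  refine ⟨⟨⟨PhiC, FibMnd.ofFamily, fun f => ?_, fun _ => rfl⟩, continuous_PhiC,
    FibMnd.continuous_ofFamily⟩, fun _ _ _ => rfl, rfl, fun f g b => ?_⟩
  · exact Subtype.ext (ContinuousMap.ext fun x => Prod.ext rfl (f.prop x).symm)
  · ext x
    change (f.val (g.val (x, b))).1 = (f.val ((g.val (x, b)).1, b)).1
    rw [show g.val (x, b) = ((g.val (x, b)).1, b) from Prod.ext rfl (g.prop (x, b))]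
end

section
/- Let F and B be locally compact Hausdorff spaces, π : F × B → B the projection, and Φ : M → C(B, C(F,F)) the map Φ(f)(b)(x) = pr_F(f(x, b)). Call f ∈ M a fibre-homotopy equivalence if there exist g ∈ M and continuous homotopies K, L : (F × B) × [0,1] → F × B, from f ∘ g to the identity and from g ∘ f to the identity respectively, such that π ∘ K(·, t) = π and π ∘ L(·, t) = π for every t ∈ [0,1]. Then f ∈ M is a fibre-homotopy equivalence if and only if Φ(f) is invertible up to homotopy in the monoid C(B, C(F,F)): there exists h ∈ C(B, C(F,F)) such that both Φ(f) · h and h · Φ(f) are homotopic, as continuous maps B → C(F,F), to the constant map at id_F. -/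
/-- Pointwise composition in `C(B, C(F, F))` (for `F` locally compact). -/
def pMul {F B : Type*} [TopologicalSpace F] [TopologicalSpace B] [LocallyCompactSpace F]
    (g h : C(B, C(F, F))) : C(B, C(F, F)) :=
  ⟨fun b => (g b).comp (h b), g.continuous.compCM h.continuous⟩

/-- `f ∈ M` is a fibre-homotopy equivalence: it has a homotopy inverse in `M` with the
homotopies themselves being maps over `B`. -/
def IsFibreHtpyEquiv {F B : Type*} [TopologicalSpace F] [TopologicalSpace B]
    (f : FibMnd F B) : Prop :=
  ∃ g : FibMnd F B,
    ∃ K : ContinuousMap.Homotopy (f.val.comp g.val) (ContinuousMap.id (F × B)),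
    ∃ L : ContinuousMap.Homotopy (g.val.comp f.val) (ContinuousMap.id (F × B)),
      (∀ (x : F × B) (t : unitInterval), (K (t, x)).2 = x.2) ∧
      (∀ (x : F × B) (t : unitInterval), (L (t, x)).2 = x.2)

/-- The fibrewise self-map `(x, b) ↦ (h b x, b)` of `F × B` determined by `h : C(B, C(F, F))`. -/
def FibMnd.ofCurried {F B : Type*} [TopologicalSpace F] [TopologicalSpace B]
    [LocallyCompactSpace F] (h : C(B, C(F, F))) : FibMnd F B :=
  ⟨⟨fun x => (h x.2 x.1, x.2), by fun_prop⟩, fun _ => rfl⟩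

theorem PhiC_ofCurried {F B : Type*} [TopologicalSpace F] [TopologicalSpace B]
    [LocallyCompactSpace F] (h : C(B, C(F, F))) : PhiC (FibMnd.ofCurried h) = h :=
  rfl

theorem PhiC_one (F B : Type*) [TopologicalSpace F] [TopologicalSpace B] :
    PhiC (FibMnd.one F B) = ContinuousMap.const B (ContinuousMap.id F) :=
  rfl

theorem PhiC_comp {F B : Type*} [TopologicalSpace F] [TopologicalSpace B]
    [LocallyCompactSpace F] (f g : FibMnd F B) :
    PhiC (f.comp g) = pMul (PhiC f) (PhiC g) := by
  ext b x
  change (f.val (g.val (x, b))).1 = (f.val ((g.val (x, b)).1, b)).1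
  exact congrArg (fun y => (f.val y).1) (Prod.ext rfl (g.prop (x, b)))

/-- Homotopies over `B` between elements of `M` correspond to homotopies between their images
in `C(B, C(F, F))`. -/
theorem PhiC_homotopic_iff {F B : Type*} [TopologicalSpace F] [TopologicalSpace B]
    [LocallyCompactSpace F] (u v : FibMnd F B) :
    (PhiC u).Homotopic (PhiC v) ↔
      ∃ H : ContinuousMap.Homotopy u.val v.val,
        ∀ (x : F × B) (t : unitInterval), (H (t, x)).2 = x.2 := by
  constructor
  · rintro ⟨G⟩
    refine ⟨⟨⟨fun p => (G (p.1, p.2.2) p.2.1, p.2.2), by fun_prop⟩, fun x => ?_, fun x => ?_⟩,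
      fun _ _ => rfl⟩
    · refine Prod.ext ?_ (u.prop x).symm
      change G (0, x.2) x.1 = _
      rw [G.apply_zero]
      rfl
    · refine Prod.ext ?_ (v.prop x).symm
      change G (1, x.2) x.1 = _
      rw [G.apply_one]
      rfl
  · rintro ⟨H, -⟩
    let G : C((unitInterval × B) × F, F) := ⟨fun p => (H (p.1.1, (p.2, p.1.2))).1, by fun_prop⟩
    refine ⟨⟨G.curry, fun b => ?_, fun b => ?_⟩⟩
    · ext x
      exact congrArg Prod.fst (H.apply_zero (x, b))
    · ext x
      exact congrArg Prod.fst (H.apply_one (x, b))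

/-- `f ∈ M` is a fibre-homotopy equivalence if and only if `Φ(f)` is invertible up to
homotopy in the monoid `C(B, C(F, F))` with pointwise composition. -/
theorem fibre_htpy_equiv_iff_invertible_up_to_homotopy
    (F B : Type*) [TopologicalSpace F] [TopologicalSpace B]
    [LocallyCompactSpace F] [T2Space F] [LocallyCompactSpace B] [T2Space B]
    (f : FibMnd F B) :
    IsFibreHtpyEquiv f ↔
      ∃ h : C(B, C(F, F)),
        (pMul (PhiC f) h).Homotopic (ContinuousMap.const B (ContinuousMap.id F)) ∧
        (pMul h (PhiC f)).Homotopic (ContinuousMap.const B (ContinuousMap.id F)) := by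
  constructor
  · rintro ⟨g, K, L, hK, hL⟩
    refine ⟨PhiC g, ?_, ?_⟩
    · rw [← PhiC_comp, ← PhiC_one]
      exact (PhiC_homotopic_iff (f.comp g) (FibMnd.one F B)).2 ⟨K, hK⟩
    · rw [← PhiC_comp, ← PhiC_one]
      exact (PhiC_homotopic_iff (g.comp f) (FibMnd.one F B)).2 ⟨L, hL⟩
  · rintro ⟨h, hr, hl⟩
    rw [← PhiC_ofCurried h, ← PhiC_comp, ← PhiC_one, PhiC_homotopic_iff] at hr hl
    obtain ⟨K, hK⟩ := hr
    obtain ⟨L, hL⟩ := hl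
    exact ⟨FibMnd.ofCurried h, K, L, hK, hL⟩
end

section
/- Let p : E → B be a Hurewicz fibration, i.e., p has the homotopy lifting property with respect to every topological space, and let K be a locally compact Hausdorff space. Then the post-composition map p_* : C(K, E) → C(K, B), p_*(u) = p ∘ u, between mapping spaces with the compact-open topology, is again a Hurewicz fibration: it has the homotopy lifting property with respect to every topological space. -/
universe u

/-- A map `p : E → B` has the homotopy lifting property with respect to a space `X`. -/
def HasHLPWrt {E B : Type*} [TopologicalSpace E] [TopologicalSpace B] (p : E → B)
    (X : Type*) [TopologicalSpace X] : Prop :=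
  ∀ (H : C(X × unitInterval, B)) (h : C(X, E)),
    (∀ x, p (h x) = H (x, 0)) →
    ∃ Ht : C(X × unitInterval, E), (∀ z, p (Ht z) = H z) ∧ ∀ x, Ht (x, 0) = h x

/-- If `p : E → B` is a Hurewicz fibration (it has the homotopy lifting property with
respect to every topological space) and `K` is locally compact Hausdorff, then the
post-composition map `p₌ : C(K, E) → C(K, B)`, `u ↦ p ∘ u`, between mapping spaces with the
compact-open topology is again a Hurewicz fibration. -/
theorem mapping_space_of_hurewicz_fibration_is_hurewicz
    {E B K : Type u} [TopologicalSpace E] [TopologicalSpace B]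
    [TopologicalSpace K] [LocallyCompactSpace K] [T2Space K] (p : C(E, B))
    (hp : ∀ (X : Type u) [TopologicalSpace X], HasHLPWrt p X) :
    ∀ (X : Type u) [TopologicalSpace X],
      HasHLPWrt (fun u : C(K, E) => p.comp u) X := by
  intro X _ H h hH
  let shuffle : C((X × K) × unitInterval, (X × unitInterval) × K) :=
    ⟨fun z => ((z.1.1, z.2), z.1.2), by fun_prop⟩
  obtain ⟨L, hpL, hL⟩ := hp (X × K) (H.uncurry.comp shuffle) h.uncurry
    fun z => DFunLike.congr_fun (hH z.1) z.2
  let unshuffle : C((X × unitInterval) × K, (X × K) × unitInterval) :=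
    ⟨fun z => ((z.1.1, z.2), z.1.2), by fun_prop⟩
  exact ⟨(L.comp unshuffle).curry,
    fun z => ContinuousMap.ext fun k => hpL ((z.1, k), z.2),
    fun x => ContinuousMap.ext fun k => hL (x, k)⟩
end
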